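/- arXiv:2602.23892 — 4 statements merged into one kernel-verified Lean document; each statement's English description precedes it below -/
import Mathlib

section
/- Nonnegativity of the Tsallis divergence: let V be a finite nonempty type, let p be a pmf on V and q a pmf on V with q(v) > 0 for all v, and let r > 0 with r ≠ 1. Then D_r(p‖q) ≥ 0, and D_r(p‖q) = 0 if and only if p = q. -/
open Finset

/-- The deformed (Tsallis) logarithm `log_r v = (v^(r-1) - 1)/(r-1)`. -/
noncomputable def qlog (r v : ℝ) : ℝ := (v ^ (r - 1) - 1) / (r - 1)

/-- A probability mass function on a finite type. -/
def IsPmf {V : Type*} [Fintype V] (p : V → ℝ) : Prop :=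
  (∀ v, 0 ≤ p v) ∧ ∑ v, p v = 1

/-- The Tsallis divergence `D_r(p‖q) = ∑_v p v · log_r (p v / q v)`,
with the convention that terms with `p v = 0` contribute `0`. -/
noncomputable def tsallisDiv (r : ℝ) {V : Type*} [Fintype V] (p q : V → ℝ) : ℝ :=
  ∑ v, if p v = 0 then 0 else p v * qlog r (p v / q v)

lemma sub_one_lt_mul_qlog {r t : ℝ} (hr0 : 0 < r) (hr1 : r ≠ 1) (ht : 0 < t) (ht1 : t ≠ 1) :
    t - 1 < t * qlog r t := by
  have hmul : t * t ^ (r - 1) = t ^ r := by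
    rw [Real.rpow_sub_one ht.ne', mul_div_cancel₀ _ ht.ne']
  have hs : -1 ≤ t - 1 := by linarith
  have hs0 : t - 1 ≠ 0 := sub_ne_zero.mpr ht1
  have hs1 : 1 + (t - 1) = t := by ring
  rw [qlog, ← mul_div_assoc, mul_sub, hmul, mul_one]
  rcases lt_or_gt_of_ne hr1 with h | h
  · have hlt := rpow_one_add_lt_one_add_mul_self hs hs0 hr0 h
    rw [hs1] at hlt
    rw [lt_div_iff_of_neg (by linarith)]
    linarith
  · have hlt := one_add_mul_self_lt_rpow_one_add hs hs0 h
    rw [hs1] at hlt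
    rw [lt_div_iff₀ (by linarith)]
    linarith

lemma sub_lt_mul_qlog_div {r a b : ℝ} (hr0 : 0 < r) (hr1 : r ≠ 1) (ha : 0 ≤ a) (hb : 0 < b)
    (hab : a ≠ b) : a - b < if a = 0 then 0 else a * qlog r (a / b) := by
  split_ifs with h
  · linarith
  · have ha' : 0 < a := ha.lt_of_ne' h
    have hlt := mul_lt_mul_of_pos_left
      (sub_one_lt_mul_qlog hr0 hr1 (div_pos ha' hb) (by rwa [Ne, div_eq_one_iff_eq hb.ne'])) hb
    rwa [mul_sub, ← mul_assoc, mul_div_cancel₀ _ hb.ne', mul_one] at hlt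

lemma tsallisDiv_self (r : ℝ) {V : Type*} [Fintype V] (p : V → ℝ) : tsallisDiv r p p = 0 := by
  refine Finset.sum_eq_zero fun v _ => ?_
  split_ifs with h
  · rfl
  · simp [qlog, div_self h]

lemma tsallisDiv_pos {V : Type*} [Fintype V] {p q : V → ℝ} (hp : IsPmf p) (hq : IsPmf q)
    (hq' : ∀ v, 0 < q v) {r : ℝ} (hr0 : 0 < r) (hr1 : r ≠ 1) (hpq : p ≠ q) :
    0 < tsallisDiv r p q := by
  have hsum : ∑ v, (p v - q v) = 0 := by rw [Finset.sum_sub_distrib, hp.2, hq.2, sub_self]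
  rw [← hsum]
  obtain ⟨w, hw⟩ := Function.ne_iff.mp hpq
  refine Finset.sum_lt_sum (fun v _ => ?_)
    ⟨w, Finset.mem_univ w, sub_lt_mul_qlog_div hr0 hr1 (hp.1 w) (hq' w) hw⟩
  by_cases hv : p v = q v
  · simp [hv, qlog, (hq' v).ne']
  · exact (sub_lt_mul_qlog_div hr0 hr1 (hp.1 v) (hq' v) hv).le

/-- nonnegativity of the Tsallis divergence, with equality iff `p = q`. -/
theorem tsallisDiv_nonneg_and_eq_zero_iff {V : Type*} [Fintype V] [Nonempty V]
    (p q : V → ℝ) (hp : IsPmf p) (hq : IsPmf q) (hq' : ∀ v, 0 < q v)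
    (r : ℝ) (hr0 : 0 < r) (hr1 : r ≠ 1) :
    0 ≤ tsallisDiv r p q ∧ (tsallisDiv r p q = 0 ↔ p = q) := by
  rcases eq_or_ne p q with rfl | hpq
  · simp [tsallisDiv_self]
  · have hpos := tsallisDiv_pos hp hq hq' hr0 hr1 hpq
    exact ⟨hpos.le, iff_of_false hpos.ne' hpq⟩
end

section
/- Non-additivity (exact chain rule) of the Tsallis divergence for a product reference: let V and Z be finite nonempty types, let r > 0 with r ≠ 1, let p_Z be a pmf on Z with p_Z(z) > 0 for all z, let p(·|z) be a pmf on V with p(v|z) > 0 for all v, for each z, and let q_V on V and q_Z on Z be pmfs with q_V(v) > 0 and q_Z(z) > 0 for all v, z. Define the joint pmfs p(v,z) = p(v|z)·p_Z(z) and q(v,z) = q_V(v)·q_Z(z) on V × Z. Then D_r(p‖q) = ∑_z p_Z(z)·D_r(p(·|z)‖q_V) + D_r(p_Z‖q_Z) + (r−1)·∑_z p_Z(z)·log_r(p_Z(z)/q_Z(z))·D_r(p(·|z)‖q_V). In particular the ordinary chain rule of the Kullback–Leibler divergence fails for r ≠ 1, with the last sum quantifying the defect. -/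
open Finset

/-- The deformed logarithm of a product: it is additive up to a cross term of weight `r - 1`. -/
theorem qlog_mul {r x y : ℝ} (hr : r ≠ 1) (hx : 0 ≤ x) (hy : 0 ≤ y) :
    qlog r (x * y) = qlog r x + qlog r y + (r - 1) * (qlog r x * qlog r y) := by
  have h : r - 1 ≠ 0 := sub_ne_zero.mpr hr
  unfold qlog
  rw [Real.mul_rpow hx hy]
  field_simp
  ring

/-- If `p` vanishes nowhere, the convention in the Tsallis divergence is not needed. -/
theorem tsallisDiv_of_ne_zero {V : Type*} [Fintype V] (r : ℝ) {p : V → ℝ} (q : V → ℝ)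
    (hp : ∀ v, p v ≠ 0) : tsallisDiv r p q = ∑ v, p v * qlog r (p v / q v) :=
  Finset.sum_congr rfl fun v _ => if_neg (hp v)

/-- non-additivity (exact chain rule) of the Tsallis divergence for a
product reference density. -/
theorem tsallisDiv_chain_rule {V Z : Type*} [Fintype V] [Nonempty V] [Fintype Z] [Nonempty Z]
    (r : ℝ) (hr0 : 0 < r) (hr1 : r ≠ 1)
    (pZ : Z → ℝ) (hpZ : IsPmf pZ) (hpZ' : ∀ z, 0 < pZ z)
    (pV : Z → V → ℝ) (hpV : ∀ z, IsPmf (pV z)) (hpV' : ∀ z v, 0 < pV z v)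
    (qV : V → ℝ) (hqV : IsPmf qV) (hqV' : ∀ v, 0 < qV v)
    (qZ : Z → ℝ) (hqZ : IsPmf qZ) (hqZ' : ∀ z, 0 < qZ z) :
    tsallisDiv r (fun vz : V × Z => pV vz.2 vz.1 * pZ vz.2)
        (fun vz : V × Z => qV vz.1 * qZ vz.2) =
      (∑ z, pZ z * tsallisDiv r (pV z) qV) + tsallisDiv r pZ qZ +
        (r - 1) * ∑ z, pZ z * qlog r (pZ z / qZ z) * tsallisDiv r (pV z) qV := by
  have hp : ∀ vz : V × Z, pV vz.2 vz.1 * pZ vz.2 ≠ 0 := fun vz =>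
    (mul_pos (hpV' vz.2 vz.1) (hpZ' vz.2)).ne'
  rw [tsallisDiv_of_ne_zero r _ hp,
    tsallisDiv_of_ne_zero r qZ fun z => (hpZ' z).ne', Fintype.sum_prod_type_right,
    ← Finset.sum_add_distrib, Finset.mul_sum, ← Finset.sum_add_distrib]
  refine Finset.sum_congr rfl fun z _ => ?_
  set L := qlog r (pZ z / qZ z) with hL
  have hterm : ∀ v, pV z v * pZ z * qlog r (pV z v * pZ z / (qV v * qZ z)) =
      (pZ z + (r - 1) * (pZ z * L)) * (pV z v * qlog r (pV z v / qV v)) +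
        pZ z * L * pV z v := fun v => by
    rw [mul_div_mul_comm, qlog_mul hr1 (div_pos (hpV' z v) (hqV' v)).le
      (div_pos (hpZ' z) (hqZ' z)).le, ← hL]
    ring
  simp only [hterm]
  rw [Finset.sum_add_distrib, ← Finset.mul_sum, ← Finset.mul_sum, (hpV z).2,
    tsallisDiv_of_ne_zero r qV fun v => (hpV' z v).ne']
  ring
end

section
/- The Tsallis divergence converges to the Kullback–Leibler divergence as r → 1: let V be a finite nonempty type, let p be a pmf on V and q a pmf on V with q(v) > 0 for all v. Then the function r ↦ D_r(p‖q), defined for r > 0, r ≠ 1, tends to the Kullback–Leibler divergence ∑_v p(v)·log(p(v)/q(v)) (with terms where p(v) = 0 contributing 0) as r → 1 along the punctured neighborhood of 1 in (0, ∞). -/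
open Finset Filter Topology

/-- The deformed logarithm tends to the natural logarithm as `r → 1`. -/
lemma tendsto_qlog_log {x : ℝ} (hx : 0 < x) :
    Tendsto (fun r : ℝ => qlog r x) (𝓝[≠] 1) (𝓝 (Real.log x)) := by
  have h : HasDerivAt (fun r : ℝ => x ^ (r - 1)) (Real.log x) 1 := by
    simpa using ((hasDerivAt_id (1 : ℝ)).sub_const 1).const_rpow hx
  refine h.tendsto_slope.congr fun r => ?_
  simp [slope_def_field, qlog]

/-- as `r → 1` along the punctured neighborhood of `1` in `(0, ∞)`,
the Tsallis divergence tends to the Kullback–Leibler divergence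
`∑_v p v · log (p v / q v)` (terms with `p v = 0` contributing `0`). -/
theorem tsallisDiv_tendsto_klDiv {V : Type*} [Fintype V] [Nonempty V]
    (p q : V → ℝ) (hp : IsPmf p) (hq : IsPmf q) (hq' : ∀ v, 0 < q v) :
    Tendsto (fun r : ℝ => tsallisDiv r p q)
      (𝓝[Set.Ioi (0 : ℝ) \ {1}] (1 : ℝ))
      (𝓝 (∑ v, if p v = 0 then 0 else p v * Real.log (p v / q v))) := by
  refine tendsto_finsetSum _ fun v _ => ?_
  split_ifs with h
  · exact tendsto_const_nhds
  · have hpq : 0 < p v / q v := div_pos ((hp.1 v).lt_of_ne' h) (hq' v)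
    exact ((tendsto_qlog_log hpq).mono_left
      (nhdsWithin_mono 1 fun r hr => hr.2)).const_mul (p v)
end

section
/- Strict convexity of the Tsallis divergence in its first argument: let V be a finite nonempty type, let q be a pmf on V with q(v) > 0 for all v, and let r > 0 with r ≠ 1. Then for any two distinct pmfs p₁ ≠ p₂ on V and any t ∈ (0,1), D_r(t·p₁ + (1−t)·p₂ ‖ q) < t·D_r(p₁‖q) + (1−t)·D_r(p₂‖q). -/
open Finset

/-- The Tsallis integrand `(x ^ r - x) / (r - 1)` is strictly convex on `[0, ∞)`. -/
theorem strictConvexOn_rpow_sub_div {r : ℝ} (hr0 : 0 < r) (hr1 : r ≠ 1) :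
    StrictConvexOn ℝ (Set.Ici 0) fun x : ℝ => (x ^ r - x) / (r - 1) := by
  refine ⟨convex_Ici 0, fun x hx y hy hxy a b ha hb hab => ?_⟩
  simp only [smul_eq_mul]
  rw [← mul_div_assoc, ← mul_div_assoc, ← add_div]
  rcases lt_or_gt_of_ne hr1 with h | h
  · have key := (Real.strictConcaveOn_rpow hr0 h).2 hx hy hxy ha hb hab
    simp only [smul_eq_mul] at key
    exact div_lt_div_of_neg_of_lt (by linarith) (by linarith)
  · have key := (strictConvexOn_rpow h).2 hx hy hxy ha hb hab
    simp only [smul_eq_mul] at key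
    exact div_lt_div_of_pos_right (by linarith) (by linarith)

/-- The Tsallis divergence as the `f`-divergence of `x ↦ (x ^ r - x) / (r - 1)`. -/
theorem tsallisDiv_eq_sum_mul {V : Type*} [Fintype V] {r : ℝ} (hr0 : 0 < r) {p q : V → ℝ}
    (hp : ∀ v, 0 ≤ p v) (hq : ∀ v, 0 < q v) :
    tsallisDiv r p q = ∑ v, q v * (((p v / q v) ^ r - p v / q v) / (r - 1)) := by
  refine Finset.sum_congr rfl fun v _ => ?_
  split_ifs with h
  · simp [h, Real.zero_rpow hr0.ne']
  · have hx : 0 < p v / q v := div_pos (lt_of_le_of_ne (hp v) (Ne.symm h)) (hq v)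
    have hpq : p v = q v * (p v / q v) := (mul_div_cancel₀ _ (hq v).ne').symm
    rw [qlog, Real.rpow_sub_one hx.ne']
    generalize p v / q v = x at *
    rw [hpq]
    field_simp

/-- strict convexity of the Tsallis divergence in its first argument. -/
theorem tsallisDiv_strictConvex {V : Type*} [Fintype V] [Nonempty V]
    (q : V → ℝ) (hq : IsPmf q) (hq' : ∀ v, 0 < q v)
    (r : ℝ) (hr0 : 0 < r) (hr1 : r ≠ 1)
    (p₁ p₂ : V → ℝ) (hp₁ : IsPmf p₁) (hp₂ : IsPmf p₂) (hne : p₁ ≠ p₂)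
    (t : ℝ) (ht0 : 0 < t) (ht1 : t < 1) :
    tsallisDiv r (fun v => t * p₁ v + (1 - t) * p₂ v) q <
      t * tsallisDiv r p₁ q + (1 - t) * tsallisDiv r p₂ q := by
  have hs : 0 < 1 - t := sub_pos.mpr ht1
  obtain ⟨w, hw⟩ := Function.ne_iff.mp hne
  have hconv := strictConvexOn_rpow_sub_div hr0 hr1
  have hmix : ∀ v, 0 ≤ t * p₁ v + (1 - t) * p₂ v := fun v =>
    add_nonneg (mul_nonneg ht0.le (hp₁.1 v)) (mul_nonneg hs.le (hp₂.1 v))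
  have hdiv : ∀ v, (t * p₁ v + (1 - t) * p₂ v) / q v =
      t * (p₁ v / q v) + (1 - t) * (p₂ v / q v) := fun v => by ring
  have hx₁ : ∀ v, p₁ v / q v ∈ Set.Ici (0 : ℝ) := fun v => div_nonneg (hp₁.1 v) (hq' v).le
  have hx₂ : ∀ v, p₂ v / q v ∈ Set.Ici (0 : ℝ) := fun v => div_nonneg (hp₂.1 v) (hq' v).le
  rw [tsallisDiv_eq_sum_mul hr0 hmix hq', tsallisDiv_eq_sum_mul hr0 hp₁.1 hq',
    tsallisDiv_eq_sum_mul hr0 hp₂.1 hq', Finset.mul_sum, Finset.mul_sum,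
    ← Finset.sum_add_distrib]
  simp only [hdiv, mul_left_comm t, mul_left_comm (1 - t) (q _), ← mul_add (q _)]
  refine Finset.sum_lt_sum (fun v _ => ?_) ⟨w, Finset.mem_univ w, ?_⟩
  · exact mul_le_mul_of_nonneg_left
      (hconv.convexOn.2 (hx₁ v) (hx₂ v) ht0.le hs.le (add_sub_cancel t 1)) (hq' v).le
  · have hne' : p₁ w / q w ≠ p₂ w / q w := fun h => hw ((div_left_inj' (hq' w).ne').mp h)
    exact mul_lt_mul_of_pos_left
      (hconv.2 (hx₁ w) (hx₂ w) hne' ht0 hs (add_sub_cancel t 1)) (hq' w)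
end
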